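/- arXiv:1311.0028 — 5 statements merged into one kernel-verified Lean document; each statement's English description precedes it below -/
import Mathlib

section
/- For every integer N ≥ 3 and every integer k with 0 ≤ k ≤ ⌊(N−1)/2⌋ − 1, the lengths of consecutive LGL intervals satisfy |Δ_{k+1}^N| > |Δ_k^N|; that is, the LGL interval lengths strictly increase from the left endpoint of [−1,1] towards the center. -/
/-- The Legendre polynomial of degree `N` via the Rodrigues formula. -/
noncomputable def legendrePoly (N : ℕ) : Polynomial ℝ :=
  Polynomial.C (1 / (2 ^ N * N.factorial : ℝ)) *
    Polynomial.derivative^[N] ((Polynomial.X ^ 2 - 1) ^ N)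

/-- The polynomial `(1 - x²)·L_N'(x)` whose zeros are the LGL nodes of order `N`. -/
noncomputable def lglPoly (N : ℕ) : Polynomial ℝ :=
  (1 - Polynomial.X ^ 2) * Polynomial.derivative (legendrePoly N)

/-- `ξ 0 < ξ 1 < ⋯ < ξ N` enumerates the Legendre-Gauss-Lobatto nodes of order `N`
in increasing order. -/
def IsLGLNodes (N : ℕ) (ξ : ℕ → ℝ) : Prop :=
  StrictMonoOn ξ (Set.Iic N) ∧ ξ 0 = -1 ∧ ξ N = 1 ∧
    (∀ k ≤ N, (lglPoly N).eval (ξ k) = 0) ∧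
    (∀ x : ℝ, (lglPoly N).eval x = 0 → ∃ k ≤ N, ξ k = x)

open Polynomial

/-- Leibniz' rule applied to the differential equation `(X² - 1) p' = 2 N X p`. -/
theorem iterate_derivative_of_sq_sub_one_mul_derivative {p : ℝ[X]} {N : ℕ}
    (hp : (X ^ 2 - 1) * derivative p = 2 * (N : ℝ[X]) * X * p) (m : ℕ) :
    (X ^ 2 - 1) * derivative^[m + 2] p
        + 2 * ((m : ℝ[X]) + 1) * X * derivative^[m + 1] p
        + ((m : ℝ[X]) + 1) * (m : ℝ[X]) * derivative^[m] p
      = 2 * (N : ℝ[X]) * X * derivative^[m + 1] p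
        + 2 * (N : ℝ[X]) * ((m : ℝ[X]) + 1) * derivative^[m] p := by
  induction m with
  | zero =>
    have h := congrArg derivative hp
    simp only [derivative_mul, derivative_sub, derivative_X_sq, derivative_X,
      derivative_natCast, derivative_one, derivative_ofNat, map_ofNat C] at h
    simp only [Function.iterate_succ_apply', Function.iterate_zero_apply]
    push_cast
    linear_combination h
  | succ m ih =>
    have h := congrArg derivative ih
    simp only [Function.iterate_succ_apply'] at h ⊢
    simp only [derivative_mul, derivative_add, derivative_sub, derivative_X_sq, derivative_X,
      derivative_natCast, derivative_one, derivative_ofNat, map_ofNat C] at h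
    push_cast
    linear_combination h

theorem sq_sub_one_mul_derivative_pow (N : ℕ) :
    (X ^ 2 - 1) * derivative ((X ^ 2 - 1 : ℝ[X]) ^ N)
      = 2 * (N : ℝ[X]) * X * (X ^ 2 - 1) ^ N := by
  cases N with
  | zero => simp
  | succ n =>
    simp [derivative_pow, map_ofNat C]
    ring

/-- Legendre's differential equation. -/
theorem legendrePoly_ode (N : ℕ) :
    derivative (lglPoly N) = -((N * (N + 1) : ℝ[X]) * legendrePoly N) := by
  have h := iterate_derivative_of_sq_sub_one_mul_derivative
    (sq_sub_one_mul_derivative_pow N) N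
  simp only [Function.iterate_succ_apply'] at h
  unfold lglPoly legendrePoly
  simp only [derivative_mul, derivative_sub, derivative_X_sq, derivative_one,
    derivative_C, map_ofNat C, zero_mul, zero_add]
  linear_combination -(C (1 / (2 ^ N * N.factorial : ℝ))) * h

/-- `u = (1 - x²) L_N'` solves `(1 - x²) u'' + N (N + 1) u = 0`. -/
theorem lglPoly_ode (N : ℕ) :
    (1 - X ^ 2) * derivative (derivative (lglPoly N))
      = -((N * (N + 1) : ℝ[X]) * lglPoly N) := by
  rw [legendrePoly_ode]
  unfold lglPoly
  simp [derivative_mul]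
  ring

theorem iterate_derivative_comp_neg_X (p : ℝ[X]) (hp : p.comp (-X) = p) (m : ℕ) :
    (derivative^[m] p).comp (-X) = (-1) ^ m * derivative^[m] p := by
  induction m with
  | zero => simpa
  | succ m ih =>
    have h := congrArg derivative ih
    rw [derivative_comp] at h
    rw [Function.iterate_succ_apply']
    have h1 : derivative ((-1 : ℝ[X]) ^ m) = 0 := by
      have : ((-1 : ℝ[X]) ^ m) = C ((-1) ^ m) := by simp
      rw [this, derivative_C]
    simp [derivative_mul, h1] at h
    rw [pow_succ]
    linear_combination -h

theorem lglPoly_eval_neg (N : ℕ) (x : ℝ) :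
    (lglPoly N).eval (-x) = (-1) ^ (N + 1) * (lglPoly N).eval x := by
  have h := congrArg (eval x)
    (iterate_derivative_comp_neg_X ((X ^ 2 - 1 : ℝ[X]) ^ N) (by simp) (N + 1))
  rw [Function.iterate_succ_apply'] at h
  simp [eval_comp] at h
  simp [lglPoly, legendrePoly, h]
  ring

theorem IsLGLNodes.neg_of_two_mul_lt {N : ℕ} {ξ : ℕ → ℝ} (hξ : IsLGLNodes N ξ) {j : ℕ}
    (hj : 2 * j < N) : ξ j < 0 := by
  obtain ⟨hmono, -, -, hroot, hall⟩ := hξ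
  by_contra! hneg
  have hrefl : ∀ i ∈ Finset.Icc (j + 1) N, ∃ l ∈ Finset.range j, ξ l = -ξ i := by
    intro i hi
    rw [Finset.mem_Icc] at hi
    obtain ⟨l, hl, hli⟩ := hall (-ξ i) (by rw [lglPoly_eval_neg, hroot i hi.2, mul_zero])
    refine ⟨l, ?_, hli⟩
    rw [Finset.mem_range]
    have h1 : ξ j < ξ i := hmono (by simp; omega) (by simp; omega) (by omega)
    exact (hmono.lt_iff_lt (by simpa using hl) (by simp; omega)).1 (by linarith)
  choose! f hf hfξ using hrefl
  have hinj : Set.InjOn f (Finset.Icc (j + 1) N) := by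
    intro a ha b hb hab
    have h1 := hfξ a ha
    have h2 := hfξ b hb
    simp only [Finset.coe_Icc, Set.mem_Icc] at ha hb
    refine hmono.injOn (Set.mem_Iic.2 ha.2) (Set.mem_Iic.2 hb.2) ?_
    rw [hab] at h1
    linarith
  have hcard := Finset.card_le_card_of_injOn f hf hinj
  simp at hcard
  omega

theorem IsLGLNodes.eval_ne_zero {N : ℕ} {ξ : ℕ → ℝ} (hξ : IsLGLNodes N ξ) {j : ℕ}
    (hj : j + 1 ≤ N) {x : ℝ} (hx : x ∈ Set.Ioo (ξ j) (ξ (j + 1))) :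
    (lglPoly N).eval x ≠ 0 := by
  intro h
  obtain ⟨l, hl, rfl⟩ := hξ.2.2.2.2 x h
  have h1 := (hξ.1.lt_iff_lt (Set.mem_Iic.2 (by omega)) (Set.mem_Iic.2 hl)).1 hx.1
  have h2 := (hξ.1.lt_iff_lt (Set.mem_Iic.2 hl) (Set.mem_Iic.2 hj)).1 hx.2
  omega

theorem exists_sign_mul_eval_pos {p : ℝ[X]} {a b : ℝ}
    (h : ∀ x ∈ Set.Ioo a b, p.eval x ≠ 0) :
    ∃ s : ℝ, ∀ x ∈ Set.Ioo a b, 0 < s * p.eval x := by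
  by_cases hpos : ∀ x ∈ Set.Ioo a b, 0 < p.eval x
  · exact ⟨1, by simpa using hpos⟩
  push Not at hpos
  obtain ⟨y, hy, hpy⟩ := hpos
  refine ⟨-1, fun x hx => ?_⟩
  by_contra! hpx
  obtain ⟨z, hz, hpz⟩ := isPreconnected_Ioo.intermediate_value hy hx
    p.continuous.continuousOn (show (0 : ℝ) ∈ Set.Icc _ _ from ⟨hpy, by linarith⟩)
  exact h z hz hpz

/-- Sturm comparison: if `p'' / p > q'' / q` on `(b, c)`, where `p` and `q` are positive and
both vanish at `b`, then `p` does not vanish at `c`. -/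
theorem sturm_comparison {p q : ℝ[X]} {b c : ℝ} (hbc : b < c)
    (hp : ∀ x ∈ Set.Ioo b c, 0 < p.eval x) (hq : ∀ x ∈ Set.Ioo b c, 0 < q.eval x)
    (hpb : p.eval b = 0) (hqb : q.eval b = 0)
    (hlt : ∀ x ∈ Set.Ioo b c, p.eval x * (derivative (derivative q)).eval x
      < (derivative (derivative p)).eval x * q.eval x) :
    p.eval c ≠ 0 := by
  intro hpc
  have hanti : StrictAntiOn (fun x => (p * derivative q - derivative p * q).eval x)
      (Set.Icc b c) := by
    refine strictAntiOn_of_deriv_neg (convex_Icc b c)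
      (Polynomial.continuous _).continuousOn fun x hx => ?_
    rw [interior_Icc] at hx
    rw [Polynomial.deriv]
    simp only [derivative_sub, derivative_mul, eval_sub, eval_add, eval_mul]
    linarith [hlt x hx]
  have hW := hanti (Set.left_mem_Icc.2 hbc.le) (Set.right_mem_Icc.2 hbc.le) hbc
  simp only [eval_sub, eval_mul, hpb, hqb, hpc, zero_mul, mul_zero, sub_zero, zero_sub] at hW
  have hmem : Set.Ioo b c ∈ nhdsWithin c (Set.Iio c) := Ioo_mem_nhdsLT hbc
  have hqc : 0 ≤ q.eval c := by
    refine ge_of_tendsto (q.continuous.continuousWithinAt (s := Set.Iio c) (x := c)) ?_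
    filter_upwards [hmem] with x hx using (hq x hx).le
  have hpc' : (derivative p).eval c ≤ 0 := by
    have ht := hasDerivWithinAt_iff_tendsto_slope' (s := Set.Iio c) (by simp) |>.1
      (p.hasDerivAt c).hasDerivWithinAt
    refine le_of_tendsto ht ?_
    filter_upwards [hmem] with x hx
    rw [slope_def_field, hpc]
    exact div_nonpos_of_nonneg_of_nonpos (by linarith [hp x hx]) (by linarith [hx.2])
  nlinarith [mul_nonneg hqc (neg_nonneg.2 hpc')]

/-- The LGL interval lengths strictly increase from the left endpoint of `[-1,1]`
towards the center: for `N ≥ 3` and `0 ≤ k ≤ ⌊(N-1)/2⌋ - 1`,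
`|Δ_{k+1}^N| > |Δ_k^N|`. -/
theorem lgl_interval_lengths_strict_mono (N : ℕ) (hN : 3 ≤ N) (ξ : ℕ → ℝ)
    (hξ : IsLGLNodes N ξ) (k : ℕ) (hk : k ≤ (N - 1) / 2 - 1) :
    ξ (k + 1) - ξ k < ξ (k + 2) - ξ (k + 1) := by
  by_contra! hle
  have hb : ξ (k + 1) < 0 := hξ.neg_of_two_mul_lt (by omega)
  have hu1 : ∀ x ∈ Set.Ioo (ξ k) (ξ (k + 1)), (lglPoly N).eval x ≠ 0 :=
    fun x hx => hξ.eval_ne_zero (by omega) hx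
  have hu2 : ∀ x ∈ Set.Ioo (ξ (k + 1)) (ξ (k + 2)), (lglPoly N).eval x ≠ 0 :=
    fun x hx => hξ.eval_ne_zero (j := k + 1) (by omega) hx
  obtain ⟨hmono, h0, -, hroot, -⟩ := hξ
  have hbc : ξ (k + 1) < ξ (k + 2) :=
    hmono (Set.mem_Iic.2 (by omega)) (Set.mem_Iic.2 (by omega)) (by omega)
  have ha : -1 ≤ ξ k := by
    rw [← h0]
    exact hmono.monotoneOn (Set.mem_Iic.2 (by omega)) (Set.mem_Iic.2 (by omega)) (by omega)
  have hrb := hroot (k + 1) (by omega)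
  have hrc := hroot (k + 2) (by omega)
  generalize ξ k = a, ξ (k + 1) = b, ξ (k + 2) = c at *
  obtain ⟨s, hs⟩ := exists_sign_mul_eval_pos hu1
  obtain ⟨t, ht⟩ := exists_sign_mul_eval_pos hu2
  have hrefl : ∀ x ∈ Set.Ioo b c, 2 * b - x ∈ Set.Ioo a b :=
    fun x hx => ⟨by linarith [hx.2], by linarith [hx.1]⟩
  refine sturm_comparison (p := C t * lglPoly N)
    (q := C s * (lglPoly N).comp (C (2 * b) - X)) hbc (by simpa using ht)
    (fun x hx => by simpa [eval_comp] using hs _ (hrefl x hx)) (by simp [hrb])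
    (by simp [eval_comp, two_mul, hrb]) (fun x hx => ?_) (by simp [hrc])
  have hy := hrefl x hx
  have hux := ht x hx
  have huy := hs _ hy
  have hodex := congrArg (eval x) (lglPoly_ode N)
  have hodey := congrArg (eval (2 * b - x)) (lglPoly_ode N)
  simp [derivative_comp, eval_comp] at hodex hodey ⊢
  generalize eval x (lglPoly N) = u, eval (2 * b - x) (lglPoly N) = v,
    eval x (derivative (derivative (lglPoly N))) = u'',
    eval (2 * b - x) (derivative (derivative (lglPoly N))) = v'' at *
  have hwy : 0 < 1 - (2 * b - x) ^ 2 := by nlinarith [hy.1, hy.2]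
  have hwxy : 1 - (2 * b - x) ^ 2 < 1 - x ^ 2 := by nlinarith [hx.1]
  have hwx := hwy.trans hwxy
  have hn : (0 : ℝ) < N * (N + 1) := by
    have : 0 < N := by omega
    positivity
  have hu : u'' = -(N * (N + 1) * u) / (1 - x ^ 2) := by
    rw [eq_div_iff hwx.ne']
    linarith
  have hv : v'' = -(N * (N + 1) * v) / (1 - (2 * b - x) ^ 2) := by
    rw [eq_div_iff hwy.ne']
    linarith
  have hinv := one_div_lt_one_div_of_lt hwy hwxy
  have key := mul_lt_mul_of_pos_left hinv (mul_pos hn (mul_pos hux huy))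
  rw [hu, hv]
  simp only [div_eq_mul_inv, one_mul] at key ⊢
  linarith
end

section
/- For every integer N ≥ 3, the boundary LGL interval satisfies 4/N² ≤ |Δ_0^N| ≤ 9π²/(2(2N+1)²). -/
open Polynomial in
theorem iterate_derivative_comp_X_sub_one (p : ℝ[X]) (n : ℕ) :
    derivative^[n] (p.comp (X - 1)) = (derivative^[n] p).comp (X - 1) := by
  induction n generalizing p with
  | zero => rfl
  | succ n ih => simp [ih, derivative_comp]

open Polynomial in
/-- The polynomial `d^(N+1)/dx^(N+1) (x² - 1)^N`, a multiple of `L_N'`, in the variable `x + 1`. -/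
noncomputable def shiftedLegendreDeriv (N : ℕ) : ℝ[X] :=
  (derivative^[N + 1] ((X ^ 2 - 1) ^ N)).comp (X - 1)

open Polynomial in
theorem shiftedLegendreDeriv_coeff (N j : ℕ) :
    (shiftedLegendreDeriv N).coeff j =
      (j + (N + 1)).descFactorial (N + 1) * ((-2) ^ (N - (j + 1)) * N.choose (j + 1)) := by
  have h : (((X : ℝ[X]) ^ 2 - 1) ^ N).comp (X - 1) = (X + C (-2)) ^ N * X ^ N := by
    rw [pow_comp, ← mul_pow]
    congr 1
    simp only [sub_comp, pow_comp, X_comp, one_comp, map_neg, map_ofNat]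
    ring
  rw [shiftedLegendreDeriv, ← iterate_derivative_comp_X_sub_one, h, coeff_iterate_derivative,
    show j + (N + 1) = (j + 1) + N by ring, coeff_mul_X_pow, coeff_X_add_C_pow, nsmul_eq_mul]

open Polynomial in
theorem shiftedLegendreDeriv_coeff_succ (N j : ℕ) (hj : j < N) :
    2 * (j + 1) * (j + 2) * (shiftedLegendreDeriv N).coeff (j + 1) =
      -((N - 1 - j) * (N + 2 + j)) * (shiftedLegendreDeriv N).coeff j := by
  obtain ⟨m, rfl⟩ : ∃ m, N = j + 1 + m := ⟨N - (j + 1), by omega⟩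
  rw [shiftedLegendreDeriv_coeff, shiftedLegendreDeriv_coeff]
  have hc := Nat.choose_succ_right_eq (j + 1 + m) (j + 1)
  have hd := Nat.succ_descFactorial (j + (j + 1 + m + 1)) (j + 1 + m + 1)
  rw [show j + (j + 1 + m + 1) + 1 - (j + 1 + m + 1) = j + 1 by omega,
    show j + (j + 1 + m + 1) + 1 = j + 1 + (j + 1 + m + 1) by ring] at hd
  rw [show j + 1 + m - (j + 1) = m by omega] at hc ⊢
  replace hc := congrArg (Nat.cast : ℕ → ℝ) hc
  replace hd := congrArg (Nat.cast : ℕ → ℝ) hd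
  rcases m with _ | m
  · simp
  rw [show j + 1 + (m + 1) - (j + 1 + 1) = m by omega, pow_succ]
  push_cast at hc hd ⊢
  linear_combination 2 * (-2 : ℝ) ^ m * (((j + 1 + (m + 1)).choose (j + 1 + 1) : ℝ) * (j + 2) * hd +
    ((j : ℝ) + 1 + (j + 1 + (m + 1) + 1)) *
      ((j + (j + 1 + (m + 1) + 1)).descFactorial (j + 1 + (m + 1) + 1) : ℝ) * hc)

open Polynomial in
theorem shiftedLegendreDeriv_natDegree_lt (N : ℕ) (hN : 0 < N) :
    (shiftedLegendreDeriv N).natDegree < N := by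
  rw [Nat.lt_iff_le_pred hN, natDegree_le_iff_coeff_eq_zero]
  intro j hj
  rw [shiftedLegendreDeriv_coeff, Nat.choose_eq_zero_of_lt (by omega)]
  simp

open Polynomial in
theorem shiftedLegendreDeriv_coeff_zero_ne (N : ℕ) (hN : 0 < N) :
    (shiftedLegendreDeriv N).coeff 0 ≠ 0 := by
  rw [shiftedLegendreDeriv_coeff]
  simp [hN.ne']

open Polynomial in
theorem eval_shiftedLegendreDeriv_eq_zero (N : ℕ) (x : ℝ) (hx : (lglPoly N).eval x = 0)
    (h₁ : x ≠ -1) (h₂ : x ≠ 1) : (shiftedLegendreDeriv N).eval (x + 1) = 0 := by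
  have h : (1 - x ^ 2) ≠ 0 := by
    rw [show 1 - x ^ 2 = (1 - x) * (x + 1) by ring]
    exact mul_ne_zero (sub_ne_zero.2 h₂.symm) (fun h => h₁ (by linarith))
  rw [lglPoly, legendrePoly, derivative_C_mul, ← Function.iterate_succ_apply' derivative] at hx
  simp only [eval_mul, eval_sub, eval_one, eval_pow, eval_X, eval_C, mul_eq_zero, h, false_or] at hx
  rcases hx with hx | hx
  · exact absurd hx (by positivity)
  · simpa [shiftedLegendreDeriv, eval_comp] using hx

open Polynomial in
/-- Newton's identities up to order three for the reciprocals of the roots of a polynomial. -/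
theorem prod_one_sub_C_mul_X_eq {ι : Type*} (s : Finset ι) (r : ι → ℝ) :
    ∃ q : ℝ[X], ∏ i ∈ s, (1 - C (r i) * X) =
      1 - C (∑ i ∈ s, r i) * X + C (((∑ i ∈ s, r i) ^ 2 - ∑ i ∈ s, r i ^ 2) / 2) * X ^ 2
      - C (((∑ i ∈ s, r i) ^ 3 - 3 * (∑ i ∈ s, r i) * (∑ i ∈ s, r i ^ 2)
        + 2 * ∑ i ∈ s, r i ^ 3) / 6) * X ^ 3 + q * X ^ 4 := by
  classical
  induction s using Finset.induction_on with
  | empty => exact ⟨0, by simp⟩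
  | insert a s ha ih =>
    obtain ⟨q, hq⟩ := ih
    simp only [Finset.prod_insert ha, Finset.sum_insert ha, hq]
    generalize (∑ i ∈ s, r i) = p₁
    generalize (∑ i ∈ s, r i ^ 2) = p₂
    generalize (∑ i ∈ s, r i ^ 3) = p₃
    refine ⟨q * (1 - C (r a) * X) + C (r a * ((p₁ ^ 3 - 3 * p₁ * p₂ + 2 * p₃) / 6)), ?_⟩
    have e₂ : ((r a + p₁) ^ 2 - (r a ^ 2 + p₂)) / 2 = (p₁ ^ 2 - p₂) / 2 + r a * p₁ := by ring
    have e₃ : ((r a + p₁) ^ 3 - 3 * (r a + p₁) * (r a ^ 2 + p₂) + 2 * (r a ^ 3 + p₃)) / 6 =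
        (p₁ ^ 3 - 3 * p₁ * p₂ + 2 * p₃) / 6 + r a * ((p₁ ^ 2 - p₂) / 2) := by ring
    rw [e₂, e₃]
    simp only [C_add, C_mul]
    ring

open Polynomial in
/-- A polynomial of degree less than `n + 1` with nonzero constant term and `n` nonzero roots is
determined by them. -/
theorem eq_C_mul_prod_one_sub_inv_mul_X {n : ℕ} (p : ℝ[X]) (hp : p.natDegree < n + 1)
    (u : Fin n → ℝ) (hu : Function.Injective u) (hu₀ : ∀ i, u i ≠ 0)
    (hroot : ∀ i, p.eval (u i) = 0) :
    p = C (p.coeff 0) * ∏ i, (1 - C (u i)⁻¹ * X) := by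
  rw [← sub_eq_zero]
  refine eq_zero_of_natDegree_lt_card_of_eval_eq_zero _ (f := fun o => Option.elim o 0 u) ?_ ?_ ?_
  · rintro (_ | i) (_ | j) h
    · rfl
    · exact absurd h.symm (hu₀ j)
    · exact absurd h (hu₀ i)
    · exact congrArg some (hu h)
  · rintro (_ | i)
    · simp [eval_prod, coeff_zero_eq_eval_zero]
    · simp only [Option.elim, eval_sub, eval_mul, eval_C, hroot, eval_prod, zero_sub, neg_eq_zero]
      exact mul_eq_zero_of_right _ (Finset.prod_eq_zero (Finset.mem_univ i) (by simp [hu₀ i]))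
  · rw [Fintype.card_option, Fintype.card_fin]
    refine lt_of_le_of_lt (natDegree_sub_le _ _) (max_lt hp (Nat.lt_succ_of_le ?_))
    refine (natDegree_C_mul_le _ _).trans ((natDegree_prod_le _ _).trans ?_)
    calc ∑ i : Fin n, (1 - C (u i)⁻¹ * X : ℝ[X]).natDegree ≤ ∑ _i : Fin n, 1 :=
          Finset.sum_le_sum fun i _ => (natDegree_sub_le _ _).trans
            (max_le (by simp) ((natDegree_C_mul_le _ _).trans natDegree_X_le))
      _ = n := by simp

open Polynomial in
/-- Power sums of the reciprocals of the roots of `shiftedLegendreDeriv N`. -/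
theorem sum_inv_pow_roots_shiftedLegendreDeriv {n : ℕ} (hn : 2 ≤ n) (u : Fin n → ℝ)
    (hu : Function.Injective u) (hu₀ : ∀ i, u i ≠ 0)
    (hroot : ∀ i, (shiftedLegendreDeriv (n + 1)).eval (u i) = 0) (M : ℝ)
    (hM : M = n * (n + 3)) :
    ∑ i, (u i)⁻¹ ^ 2 = M * (M + 8) / 48 ∧
      ∑ i, (u i)⁻¹ ^ 3 = M * (M ^ 2 + 10 * M + 40) / 384 := by
  have hprod := eq_C_mul_prod_one_sub_inv_mul_X _
    (shiftedLegendreDeriv_natDegree_lt (n + 1) n.succ_pos) u hu hu₀ hroot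
  obtain ⟨q, hq⟩ := prod_one_sub_C_mul_X_eq Finset.univ fun i => (u i)⁻¹
  have h₀ := shiftedLegendreDeriv_coeff_zero_ne (n + 1) n.succ_pos
  have r₁ := shiftedLegendreDeriv_coeff_succ (n + 1) 0 (by omega)
  have r₂ := shiftedLegendreDeriv_coeff_succ (n + 1) 1 (by omega)
  have r₃ := shiftedLegendreDeriv_coeff_succ (n + 1) 2 (by omega)
  rw [hq] at hprod
  generalize (∑ i, (u i)⁻¹) = p₁ at *
  generalize (∑ i, (u i)⁻¹ ^ 2) = p₂ at *
  generalize (∑ i, (u i)⁻¹ ^ 3) = p₃ at *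
  have c₁ := congrArg (coeff · 1) hprod
  have c₂ := congrArg (coeff · 2) hprod
  have c₃ := congrArg (coeff · 3) hprod
  simp only [coeff_C_mul, coeff_add, coeff_sub, coeff_one, coeff_X,
    coeff_mul_X_pow'] at c₁ c₂ c₃
  norm_num at c₁ c₂ c₃ r₁ r₂ r₃
  generalize (shiftedLegendreDeriv (n + 1)).coeff 0 = a at *
  rw [c₁] at r₁ r₂
  rw [c₂] at r₂ r₃
  rw [c₃] at r₃
  have e₁ : p₁ = M / 4 := mul_left_cancel₀ h₀ (by rw [hM]; linear_combination -r₁ / 4)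
  have e₂ : p₂ = M * (M + 8) / 48 := by
    rw [e₁] at r₂
    refine mul_left_cancel₀ h₀ ?_
    rw [hM] at r₂ ⊢
    linear_combination -r₂ / 6
  refine ⟨e₂, mul_left_cancel₀ h₀ ?_⟩
  rw [e₁, e₂, hM] at r₃
  rw [hM]
  linear_combination -r₃ / 8

open Real in
/-- Bounds on the boundary LGL interval: for `N ≥ 3`,
`4/N² ≤ |Δ_0^N| ≤ 9π²/(2(2N+1)²)`. -/
theorem lgl_boundary_interval_bounds (N : ℕ) (hN : 3 ≤ N) (ξ : ℕ → ℝ)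
    (hξ : IsLGLNodes N ξ) :
    4 / (N : ℝ) ^ 2 ≤ ξ 1 - ξ 0 ∧
    ξ 1 - ξ 0 ≤ 9 * π ^ 2 / (2 * (2 * (N : ℝ) + 1) ^ 2) := by
  obtain ⟨hmono, h0, hlast, hzero, -⟩ := hξ
  obtain ⟨n, rfl⟩ : ∃ n, N = n + 1 := ⟨N - 1, by omega⟩
  have hlt : ∀ i j, i < j → j ≤ n + 1 → ξ i < ξ j := fun i j hij hj =>
    hmono (Set.mem_Iic.2 (hij.le.trans hj)) (Set.mem_Iic.2 hj) hij
  set u : Fin n → ℝ := fun i => ξ (i + 1) + 1 with hu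
  have hpos : ∀ i, 0 < u i := fun i => by
    have := hlt 0 (i + 1) (by omega) (by omega)
    simp only [hu]; linarith
  have hinj : Function.Injective u := fun i j hij => by
    have := hmono.injOn (Set.mem_Iic.2 (by omega)) (Set.mem_Iic.2 (by omega))
      (add_right_cancel hij)
    exact Fin.ext (by omega)
  have hroot : ∀ i, (shiftedLegendreDeriv (n + 1)).eval (u i) = 0 := fun i => by
    refine eval_shiftedLegendreDeriv_eq_zero _ _ (hzero _ (by omega)) ?_ ?_
    · rw [← h0]; exact (hlt _ _ (by omega) (by omega)).ne'
    · rw [← hlast]; exact (hlt _ _ (by omega) (by omega)).ne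
  obtain ⟨hp₂, hp₃⟩ := sum_inv_pow_roots_shiftedLegendreDeriv (by omega) u hinj
    (fun i => (hpos i).ne') hroot _ rfl
  let i₀ : Fin n := ⟨0, by omega⟩
  have hmin : ∀ i, u i₀ ≤ u i := fun i => by
    have := hmono.monotoneOn (Set.mem_Iic.2 (show 1 ≤ n + 1 by omega))
      (Set.mem_Iic.2 (show (i : ℕ) + 1 ≤ n + 1 by omega)) (by omega)
    simpa [hu, i₀] using this
  have hsq : (u i₀)⁻¹ ^ 2 ≤ ∑ i, (u i)⁻¹ ^ 2 :=
    Finset.single_le_sum (f := fun i => (u i)⁻¹ ^ 2) (fun i _ => by positivity)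
      (Finset.mem_univ i₀)
  have hcube : ∑ i, (u i)⁻¹ ^ 3 ≤ (u i₀)⁻¹ * ∑ i, (u i)⁻¹ ^ 2 := by
    rw [Finset.mul_sum]
    refine Finset.sum_le_sum fun i _ => ?_
    rw [pow_succ' _ 2]
    exact mul_le_mul_of_nonneg_right (inv_anti₀ (hpos _) (hmin i)) (by positivity)
  have hgap : ξ 1 - ξ 0 = u i₀ := by simp [hu, i₀, h0]
  rw [hgap]
  rw [hp₂] at hsq hcube
  rw [hp₃] at hcube
  have hn : (2 : ℝ) ≤ n := by exact_mod_cast (by omega : 2 ≤ n)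
  have hv := hpos i₀
  generalize u i₀ = v at *
  push_cast
  constructor
  · have h : v⁻¹ ≤ ((n : ℝ) + 1) ^ 2 / 4 := by
      refine abs_le_of_sq_le_sq' (hsq.trans ?_) (by positivity) |>.2
      obtain ⟨m, hm⟩ : ∃ m : ℝ, (n : ℝ) = m + 2 := ⟨n - 2, by ring⟩
      have hm₀ : 0 ≤ m := by linarith
      rw [hm, ← sub_nonneg]
      ring_nf
      positivity
    rw [div_le_iff₀ (by positivity)]
    rw [inv_le_iff_one_le_mul₀ hv] at h
    linarith
  · obtain ⟨M, hM⟩ : ∃ M : ℝ, M = n * (n + 3) := ⟨_, rfl⟩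
    rw [← hM] at hcube
    have hM₀ : 0 < M := by rw [hM]; positivity
    have hπ : (9 : ℝ) ≤ π ^ 2 := by nlinarith [pi_gt_three]
    have hv' : v * (M ^ 2 + 10 * M + 40) ≤ 8 * (M + 8) := by
      rw [inv_mul_eq_div, le_div_iff₀ hv] at hcube
      refine le_of_mul_le_mul_left ?_ hM₀
      linarith
    rw [le_div_iff₀ (by positivity), show (2 * ((n : ℝ) + 1) + 1) ^ 2 = 4 * M + 9 by rw [hM]; ring]
    refine le_trans ?_ (mul_le_mul_of_nonneg_left hπ (by norm_num : (0 : ℝ) ≤ 9))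
    refine le_of_mul_le_mul_right ?_ (show 0 < M ^ 2 + 10 * M + 40 by positivity)
    nlinarith [mul_le_mul_of_nonneg_left hv' (show 0 ≤ 2 * (4 * M + 9) by positivity), sq_nonneg M]
end

section
/- Monotonicity and quasi-uniformity of CGL grids: for every integer N ≥ 1, (i) |Λ_{k−1}^N| ≤ |Λ_k^N| for every integer k with 1 ≤ k ≤ ⌊(N−1)/2⌋, and (ii) 2/(3π) ≤ |Λ_k^N|/|Λ_{k−1}^N| ≤ 3π/2 for every integer k with 1 ≤ k ≤ N−1. -/
/-- The Chebyshev-Gauss-Lobatto node `ζ_k^N = -cos(kπ/N)`. -/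
noncomputable def cgl (N k : ℕ) : ℝ := -Real.cos (k * Real.pi / N)

open Real in
/-- The length of a Chebyshev-Gauss-Lobatto interval in product form. -/
theorem cgl_succ_sub_cgl (N k : ℕ) :
    cgl N (k + 1) - cgl N k = 2 * sin (π / (2 * N)) * sin ((2 * k + 1) * (π / (2 * N))) := by
  have h₁ : ((k + 1 : ℕ) : ℝ) * π / N = (2 * k + 1) * (π / (2 * N)) + π / (2 * N) := by
    push_cast; ring
  have h₂ : (k : ℝ) * π / N = (2 * k + 1) * (π / (2 * N)) - π / (2 * N) := by ring
  rw [cgl, cgl, h₁, h₂, cos_add, cos_sub]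
  ring

open Real in
theorem sin_add_two_mul_le_three_mul_sin {a h : ℝ} (h₀ : 0 ≤ h) (h₁ : h ≤ π / 2)
    (ha : h ≤ a) (haπ : a ≤ π) : sin (a + 2 * h) ≤ 3 * sin a := by
  have hs : 0 ≤ sin a := sin_nonneg_of_nonneg_of_le_pi (h₀.trans ha) haπ
  have hd : 0 ≤ sin (a - h) := sin_nonneg_of_nonneg_of_le_pi (by linarith) (by linarith)
  have hc : 0 ≤ cos h := cos_nonneg_of_neg_pi_div_two_le_of_le (by linarith) h₁
  have key : 3 * sin a - sin (a + 2 * h) = 4 * (sin h ^ 2 * sin a) + 2 * (cos h * sin (a - h)) := by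
    rw [sin_add, sin_sub, cos_two_mul, sin_two_mul, sin_sq]
    ring
  have h₃ := mul_nonneg (sq_nonneg (sin h)) hs
  have h₄ := mul_nonneg hc hd
  linarith

open Real in
/-- Monotonicity and quasi-uniformity of CGL grids: for `N ≥ 1`,
(i) `|Λ_{k-1}^N| ≤ |Λ_k^N|` for `1 ≤ k ≤ ⌊(N-1)/2⌋`, and
(ii) `2/(3π) ≤ |Λ_k^N|/|Λ_{k-1}^N| ≤ 3π/2` for `1 ≤ k ≤ N-1`. -/
theorem cgl_monotone_and_quasi_uniform (N : ℕ) (hN : 1 ≤ N) :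
    (∀ k : ℕ, 1 ≤ k → k ≤ (N - 1) / 2 →
      cgl N k - cgl N (k - 1) ≤ cgl N (k + 1) - cgl N k) ∧
    (∀ k : ℕ, 1 ≤ k → k ≤ N - 1 →
      2 / (3 * π) ≤ (cgl N (k + 1) - cgl N k) / (cgl N k - cgl N (k - 1)) ∧
      (cgl N (k + 1) - cgl N k) / (cgl N k - cgl N (k - 1)) ≤ 3 * π / 2) := by
  have hN₁ : (1 : ℝ) ≤ N := by exact_mod_cast hN
  have hNpos : (0 : ℝ) < N := by linarith
  have hNh : N * (π / (2 * N)) = π / 2 := by field_simp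
  have hpos : 0 < π / (2 * N) := by positivity
  have hle : π / (2 * N) ≤ π / 2 := by nlinarith
  have hsin : 0 < sin (π / (2 * N)) := sin_pos_of_pos_of_lt_pi hpos (by linarith [pi_pos])
  constructor
  · rintro (_ | m) hk hkN
    · omega
    rw [Nat.add_sub_cancel, cgl_succ_sub_cgl, cgl_succ_sub_cgl]
    have hm : (2 * m + 3 : ℝ) ≤ N := by
      exact_mod_cast (by omega : 2 * m + 3 ≤ N)
    push_cast
    generalize π / (2 * (N : ℝ)) = h at *
    have hmh := mul_le_mul_of_nonneg_right hm hpos.le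
    have hm₀ : 0 ≤ m * h := by positivity
    refine mul_le_mul_of_nonneg_left (sin_le_sin_of_le_of_le_pi_div_two ?_ ?_ ?_) (by positivity) <;>
      linarith [pi_pos]
  · rintro (_ | m) hk hkN
    · omega
    rw [Nat.add_sub_cancel, cgl_succ_sub_cgl, cgl_succ_sub_cgl,
      mul_div_mul_left _ _ (by positivity)]
    have hm : (m + 2 : ℝ) ≤ N := by
      exact_mod_cast (by omega : m + 2 ≤ N)
    push_cast
    generalize π / (2 * (N : ℝ)) = h at *
    have hmh := mul_le_mul_of_nonneg_right hm hpos.le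
    have hm₀ : 0 ≤ m * h := by positivity
    have hS : 0 < sin ((2 * m + 1) * h) := sin_pos_of_pos_of_lt_pi (by positivity) (by linarith)
    have hup : sin ((2 * (m + 1) + 1) * h) ≤ 3 * sin ((2 * m + 1) * h) := by
      convert sin_add_two_mul_le_three_mul_sin (a := (2 * m + 1) * h) hpos.le hle
        (by linarith) (by linarith) using 2
      ring
    have hlow : sin ((2 * m + 1) * h) ≤ 3 * sin ((2 * (m + 1) + 1) * h) := by
      have := sin_add_two_mul_le_three_mul_sin (a := π - (2 * (m + 1) + 1) * h) hpos.le hle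
        (by linarith) (by linarith)
      rwa [sin_pi_sub, show π - (2 * (m + 1) + 1) * h + 2 * h = π - (2 * m + 1) * h by ring,
        sin_pi_sub] at this
    have hπ := pi_gt_three
    constructor
    · calc 2 / (3 * π) ≤ 1 / 3 := by
            rw [div_le_div_iff₀ (by positivity) (by norm_num)]; linarith
        _ ≤ _ := by rw [div_le_div_iff₀ (by norm_num) hS]; linarith
    · rw [div_le_iff₀ hS]
      nlinarith
end

section
/- Displacement of CGL intervals: let N ≥ 1 and m ≥ 0 be integers, let k be an integer with 0 ≤ k ≤ ⌊(N−1)/2⌋, and let j be an integer with 0 ≤ j ≤ N+m−1. If ζ_j^{N+m} ≤ ζ_k^N, then the corresponding CGL intervals satisfy |Λ_j^{N+m}| ≤ |Λ_k^N|. -/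
/-- The length of a CGL interval in product form. -/
theorem cgl_succ_sub (N k : ℕ) :
    cgl N (k + 1) - cgl N k =
      2 * Real.sin (k * Real.pi / N + Real.pi / N / 2) * Real.sin (Real.pi / N / 2) := by
  have h := Real.cos_sub_cos (k * Real.pi / N) ((k + 1 : ℕ) * Real.pi / N)
  have h₁ : (k * Real.pi / N + (k + 1 : ℕ) * Real.pi / N) / 2 =
      k * Real.pi / N + Real.pi / N / 2 := by
    push_cast; ring
  have h₂ : (k * Real.pi / N - (k + 1 : ℕ) * Real.pi / N) / 2 = -(Real.pi / N / 2) := by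
    push_cast; ring
  rw [h₁, h₂, Real.sin_neg] at h
  unfold cgl
  linarith

/-- Displacement of CGL intervals: for `N ≥ 1`, `m ≥ 0`, `0 ≤ k ≤ ⌊(N-1)/2⌋` and
`0 ≤ j ≤ N+m-1`, if `ζ_j^{N+m} ≤ ζ_k^N` then `|Λ_j^{N+m}| ≤ |Λ_k^N|`. -/
theorem cgl_interval_displacement (N m : ℕ) (hN : 1 ≤ N)
    (k j : ℕ) (hk : k ≤ (N - 1) / 2) (hj : j ≤ N + m - 1)
    (hle : cgl (N + m) j ≤ cgl N k) :
    cgl (N + m) (j + 1) - cgl (N + m) j ≤ cgl N (k + 1) - cgl N k := by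
  have hπ := Real.pi_pos
  have hN' : (0 : ℝ) < N := by exact_mod_cast hN
  have hM' : (0 : ℝ) < (N + m : ℕ) := by exact_mod_cast (by omega : 0 < N + m)
  have hjM : (j : ℝ) ≤ (N + m : ℕ) := by exact_mod_cast (by omega : j ≤ N + m)
  have hkN : 2 * (k : ℝ) + 1 ≤ N := by exact_mod_cast (by omega : 2 * k + 1 ≤ N)
  have hstep : Real.pi / (N + m : ℕ) ≤ Real.pi / N := by
    gcongr
    omega
  have hstep_pos : 0 < Real.pi / (N + m : ℕ) := by positivity
  have ha : 0 ≤ j * Real.pi / (N + m : ℕ) := by positivity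
  have haπ : j * Real.pi / (N + m : ℕ) ≤ Real.pi := by
    rw [div_le_iff₀ hM']
    nlinarith
  have hb : 0 ≤ k * Real.pi / N := by positivity
  have hmid : k * Real.pi / N + Real.pi / N / 2 ≤ Real.pi / 2 := by
    have : k * Real.pi / N + Real.pi / N / 2 = (2 * k + 1) * Real.pi / N / 2 := by ring
    rw [this]
    gcongr
    rw [div_le_iff₀ hN']
    nlinarith
  have hab : j * Real.pi / (N + m : ℕ) ≤ k * Real.pi / N := by
    refine (Real.strictAntiOn_cos.le_iff_ge ⟨hb, by linarith⟩ ⟨ha, haπ⟩).1 ?_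
    unfold cgl at hle
    linarith
  rw [cgl_succ_sub, cgl_succ_sub]
  have hsin : Real.sin (j * Real.pi / (N + m : ℕ) + Real.pi / (N + m : ℕ) / 2) ≤
      Real.sin (k * Real.pi / N + Real.pi / N / 2) :=
    Real.sin_le_sin_of_le_of_le_pi_div_two (by linarith) hmid (by linarith)
  have hsin' : Real.sin (Real.pi / (N + m : ℕ) / 2) ≤ Real.sin (Real.pi / N / 2) :=
    Real.sin_le_sin_of_le_of_le_pi_div_two (by linarith) (by linarith) (by linarith)
  have hpos : 0 ≤ Real.sin (Real.pi / (N + m : ℕ) / 2) :=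
    Real.sin_nonneg_of_nonneg_of_le_pi (by linarith) (by linarith)
  have hpos' : 0 ≤ Real.sin (k * Real.pi / N + Real.pi / N / 2) :=
    Real.sin_nonneg_of_nonneg_of_le_pi (by linarith) (by linarith)
  gcongr
end

section
/- Uniform comparability of LGL and CGL intervals: there exist constants c₁, c₂ > 0 such that for every integer N ≥ 1 and every integer k with 0 ≤ k ≤ N−1, one has c₁·|Λ_k^N| ≤ |Δ_k^N| ≤ c₂·|Λ_k^N|. -/
open Polynomial in
theorem iterate_derivative_sq_sub_one_pow_ode (n k : ℕ) :
    (X ^ 2 - 1 : ℝ[X]) * derivative^[k + 2] ((X ^ 2 - 1) ^ n)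
      + 2 * ((k : ℝ[X]) + 1 - (n : ℝ[X])) * X * derivative^[k + 1] ((X ^ 2 - 1) ^ n)
      + ((k : ℝ[X]) * ((k : ℝ[X]) + 1) - 2 * (n : ℝ[X]) * ((k : ℝ[X]) + 1)) * derivative^[k] ((X ^ 2 - 1) ^ n) = 0 := by
  induction k with
  | zero =>
    have h : (X ^ 2 - 1 : ℝ[X]) * derivative ((X ^ 2 - 1) ^ n)
        = 2 * (n : ℝ[X]) * X * (X ^ 2 - 1) ^ n := by
      cases n with
      | zero => simp
      | succ m =>
        simp only [derivative_pow, derivative_sub, derivative_X, derivative_one,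
          Nat.add_sub_cancel, Nat.cast_add, Nat.cast_one, map_add, map_natCast, map_one]
        simp
        ring
    have h2 := congrArg derivative h
    simp only [derivative_mul, derivative_sub, derivative_X_pow, derivative_one,
      derivative_natCast, derivative_ofNat, derivative_X, Nat.cast_ofNat, map_ofNat] at h2
    simp only [Function.iterate_succ, Function.iterate_zero, Function.comp, id]
    norm_num at h2 ⊢
    linear_combination h2
  | succ k ih =>
    have h2 := congrArg derivative ih
    simp only [derivative_mul, derivative_add, derivative_sub, derivative_X_pow, derivative_one,
      derivative_natCast, derivative_ofNat, derivative_X, Nat.cast_ofNat, map_ofNat, derivative_zero,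
      ← Function.iterate_succ_apply' derivative] at h2
    push_cast
    norm_num at h2 ⊢
    linear_combination h2

/-- The Legendre differential equation. -/
theorem legendrePoly_ode_s10 (N : ℕ) (x : ℝ) :
    (1 - x ^ 2) * (legendrePoly N).derivative.derivative.eval x
      - 2 * x * (legendrePoly N).derivative.eval x
      + N * (N + 1) * (legendrePoly N).eval x = 0 := by
  have h := congrArg (Polynomial.eval x) (iterate_derivative_sq_sub_one_pow_ode N N)
  simp only [legendrePoly, Polynomial.derivative_C_mul,
    ← Function.iterate_succ_apply' Polynomial.derivative, Polynomial.eval_mul, Polynomial.eval_C]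
  simp only [Polynomial.eval_mul, Polynomial.eval_add, Polynomial.eval_sub, Polynomial.eval_pow,
    Polynomial.eval_X, Polynomial.eval_one, Polynomial.eval_natCast, Polynomial.eval_ofNat,
    Polynomial.eval_zero] at h
  simp only [Nat.succ_eq_add_one, add_assoc, Nat.reduceAdd] at h ⊢
  linear_combination (-(1 / (2 ^ N * N.factorial : ℝ))) * h

/-- The differential equation of the derivative of the Legendre polynomial. -/
theorem derivative_legendrePoly_ode (N : ℕ) (x : ℝ) :
    (1 - x ^ 2) * (legendrePoly N).derivative.derivative.derivative.eval x
      - 4 * x * (legendrePoly N).derivative.derivative.eval x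
      + (N * (N + 1) - 2) * (legendrePoly N).derivative.eval x = 0 := by
  have hp : (1 - Polynomial.X ^ 2) * (legendrePoly N).derivative.derivative
      - 2 * Polynomial.X * (legendrePoly N).derivative
      + (N : Polynomial ℝ) * ((N : Polynomial ℝ) + 1) * legendrePoly N = 0 := by
    refine Polynomial.funext fun x => ?_
    simpa using legendrePoly_ode_s10 N x
  have h := congrArg (fun p => Polynomial.eval x (Polynomial.derivative p)) hp
  simp at h
  linear_combination h

theorem hasDerivAt_eval_neg_cos (q : Polynomial ℝ) (t : ℝ) :
    HasDerivAt (fun t => q.eval (-Real.cos t))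
      (q.derivative.eval (-Real.cos t) * Real.sin t) t := by
  have h := (q.hasDerivAt (-Real.cos t)).comp t (Real.hasDerivAt_cos t).neg
  simpa [Function.comp_def] using h

theorem hasDerivAt_sqrt_sin {t : ℝ} (ht : 0 < Real.sin t) :
    HasDerivAt (fun t => √(Real.sin t)) (√(Real.sin t) * Real.cos t / (2 * Real.sin t)) t := by
  have h := (Real.hasDerivAt_sin t).sqrt ht.ne'
  convert h using 1
  have h1 := Real.sq_sqrt ht.le
  have h2 := Real.sqrt_pos.2 ht
  field_simp
  linear_combination Real.cos t * h1

/-- Sturm comparison from below: a solution of Legendre's equation has no sign on an interval of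
angular length `π / (N + 1/2)`. -/
theorem not_forall_pos_of_legendre_ode {N : ℕ} {q : Polynomial ℝ}
    (hq : ∀ x : ℝ, (1 - x ^ 2) * q.derivative.derivative.eval x - 2 * x * q.derivative.eval x
      + N * (N + 1) * q.eval x = 0) {a b : ℝ} (ha : 0 < a) (hb : b < Real.pi)
    (hab : ((N : ℝ) + 1 / 2) * (b - a) = Real.pi) :
    ¬ ∀ t ∈ Set.Icc a b, 0 < q.eval (-Real.cos t) := by
  intro hpos
  set w : ℝ := (N : ℝ) + 1 / 2 with hw
  have hw0 : 0 < w := by positivity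
  have hlt : a < b := by
    have : 0 < w * (b - a) := hab ▸ Real.pi_pos
    have := (pos_iff_pos_of_mul_pos this).1 hw0
    linarith
  have hsin : ∀ t ∈ Set.Icc a b, 0 < Real.sin t := fun t ht =>
    Real.sin_pos_of_pos_of_lt_pi (ha.trans_le ht.1) (ht.2.trans_lt hb)
  let W : ℝ → ℝ := fun t => √(Real.sin t) *
    (q.eval (-Real.cos t) * (Real.cos (w * (t - a)) * w)
      - q.derivative.eval (-Real.cos t) * Real.sin t * Real.sin (w * (t - a))
      - Real.cos t / (2 * Real.sin t) * (q.eval (-Real.cos t) * Real.sin (w * (t - a))))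
  have hW : ∀ t ∈ Set.Icc a b, HasDerivAt W (√(Real.sin t) * (1 / (4 * Real.sin t ^ 2)) *
      (q.eval (-Real.cos t) * Real.sin (w * (t - a)))) t := by
    intro t ht
    have hs := hsin t ht
    have hl : HasDerivAt (fun t => w * (t - a)) w t := by
      simpa using ((hasDerivAt_id t).sub_const a).const_mul w
    have d0 := hasDerivAt_eval_neg_cos q t
    have d1 := (hasDerivAt_eval_neg_cos q.derivative t).mul (Real.hasDerivAt_sin t)
    have dc := (Real.hasDerivAt_cos t).div ((Real.hasDerivAt_sin t).const_mul 2)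
      (by positivity)
    have h := (hasDerivAt_sqrt_sin hs).mul (((d0.mul (hl.cos.mul_const w)).sub
      (d1.mul hl.sin)).sub (dc.mul (d0.mul hl.sin)))
    refine h.congr_deriv ?_
    have ho := hq (-Real.cos t)
    have hsc := Real.sin_sq_add_cos_sq t
    have ho' : q.derivative.derivative.eval (-Real.cos t) * Real.sin t ^ 2 =
      - 2 * Real.cos t * q.derivative.eval (-Real.cos t)
        - N * (N + 1) * q.eval (-Real.cos t) := by
      linear_combination ho + q.derivative.derivative.eval (-Real.cos t) * hsc
    simp only [Pi.mul_apply, Pi.sub_apply, Pi.div_apply]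
    field_simp
    linear_combination (-16 * Real.sin t ^ 2 * Real.sin (w * (t - a))) * ho'
      + 4 * q.eval (-Real.cos t) * Real.sin (w * (t - a)) * hsc
  have hmono : MonotoneOn W (Set.Icc a b) := by
    refine monotoneOn_of_deriv_nonneg (convex_Icc a b)
      (fun t ht => (hW t ht).continuousAt.continuousWithinAt) ?_ ?_
    · intro t ht
      exact (hW t (interior_subset ht)).differentiableAt.differentiableWithinAt
    · intro t ht
      have ht' := interior_subset ht
      rw [(hW t ht').deriv]
      have h1 := hpos t ht'
      have h2 : 0 ≤ Real.sin (w * (t - a)) := by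
        refine Real.sin_nonneg_of_nonneg_of_le_pi
          (mul_nonneg hw0.le (sub_nonneg.2 ht'.1)) ?_
        rw [← hab]
        exact mul_le_mul_of_nonneg_left (by linarith [ht'.2]) hw0.le
      positivity
  have hA := Set.left_mem_Icc.2 hlt.le
  have hB := Set.right_mem_Icc.2 hlt.le
  have h := hmono hA hB hlt.le
  have hWa : 0 < W a := by
    have := hpos a hA
    have := hsin a hA
    simp [W]
    positivity
  have hWb : W b < 0 := by
    have h1 := hpos b hB
    have h2 := Real.sqrt_pos.2 (hsin b hB)
    simp only [W, hab, Real.cos_pi, Real.sin_pi]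
    have : 0 < √(Real.sin b) * (q.eval (-Real.cos b) * w) := by positivity
    linarith
  linarith

/-- Sturm comparison from above: zeros of `sin t * L_N'(-cos t)` in `[0, π]` are at least
`π / (N + 1/2)` apart. -/
theorem pi_le_of_derivative_legendre_ode {N : ℕ} {q : Polynomial ℝ}
    (hq : ∀ x : ℝ, (1 - x ^ 2) * q.derivative.derivative.eval x - 4 * x * q.derivative.eval x
      + (N * (N + 1) - 2) * q.eval x = 0) {a b : ℝ} (ha : 0 ≤ a) (hlt : a < b)
    (hb : b ≤ Real.pi) (hqa : Real.sin a * q.eval (-Real.cos a) = 0)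
    (hqb : Real.sin b * q.eval (-Real.cos b) = 0)
    (hpos : ∀ t ∈ Set.Ioo a b, 0 < q.eval (-Real.cos t)) :
    Real.pi ≤ ((N : ℝ) + 1 / 2) * (b - a) := by
  by_contra! hab
  set w : ℝ := (N : ℝ) + 1 / 2 with hw
  have hw0 : 0 < w := by positivity
  have hsin : ∀ t ∈ Set.Ioo a b, 0 < Real.sin t := fun t ht =>
    Real.sin_pos_of_pos_of_lt_pi (ha.trans_lt ht.1) (ht.2.trans_le hb)
  let W : ℝ → ℝ := fun t => √(Real.sin t) *
    (Real.sin t * q.eval (-Real.cos t) * (Real.cos (w * (t - a)) * w)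
      - Real.sin t * (q.derivative.eval (-Real.cos t) * Real.sin t) * Real.sin (w * (t - a))
      - 3 / 2 * Real.cos t * (q.eval (-Real.cos t) * Real.sin (w * (t - a))))
  have hW : ∀ t ∈ Set.Ioo a b, HasDerivAt W (-(√(Real.sin t) * (3 / (4 * Real.sin t)) *
      (q.eval (-Real.cos t) * Real.sin (w * (t - a))))) t := by
    intro t ht
    have hs := hsin t ht
    have hl : HasDerivAt (fun t => w * (t - a)) w t := by
      simpa using ((hasDerivAt_id t).sub_const a).const_mul w
    have d0 := hasDerivAt_eval_neg_cos q t
    have d1 := (hasDerivAt_eval_neg_cos q.derivative t).mul (Real.hasDerivAt_sin t)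
    have h := (hasDerivAt_sqrt_sin hs).mul
      (((((Real.hasDerivAt_sin t).mul d0).mul (hl.cos.mul_const w)).sub
      (((Real.hasDerivAt_sin t).mul d1).mul hl.sin)).sub
      (((Real.hasDerivAt_cos t).const_mul (3 / 2)).mul (d0.mul hl.sin)))
    refine h.congr_deriv ?_
    have ho := hq (-Real.cos t)
    have hsc := Real.sin_sq_add_cos_sq t
    have ho' : q.derivative.derivative.eval (-Real.cos t) * Real.sin t ^ 2 =
      - 4 * Real.cos t * q.derivative.eval (-Real.cos t)
        - (N * (N + 1) - 2) * q.eval (-Real.cos t) := by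
      linear_combination ho + q.derivative.derivative.eval (-Real.cos t) * hsc
    simp only [Pi.mul_apply, Pi.sub_apply]
    field_simp
    linear_combination (-16 * Real.sin t ^ 2 * Real.sin (w * (t - a))) * ho'
      - 12 * q.eval (-Real.cos t) * Real.sin (w * (t - a)) * hsc
  have hcont : Continuous W := by fun_prop
  have hs0 : ∀ t ∈ Set.Ioc a b, 0 < Real.sin (w * (t - a)) := by
    intro t ht
    refine Real.sin_pos_of_pos_of_lt_pi (mul_pos hw0 (sub_pos.2 ht.1)) (lt_of_le_of_lt ?_ hab)
    exact mul_le_mul_of_nonneg_left (by linarith [ht.2]) hw0.le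
  have hanti : StrictAntiOn W (Set.Icc a b) := by
    refine strictAntiOn_of_deriv_neg (convex_Icc a b) hcont.continuousOn ?_
    intro t ht
    rw [interior_Icc] at ht
    rw [(hW t ht).deriv]
    have h1 := hpos t ht
    have h2 := hs0 t ⟨ht.1, ht.2.le⟩
    have h3 := hsin t ht
    exact neg_neg_of_pos (by positivity)
  have h := hanti (Set.left_mem_Icc.2 hlt.le) (Set.right_mem_Icc.2 hlt.le) hlt
  have hWa : W a = 0 := by simp [W, hqa]
  have hWb : 0 ≤ W b := by
    rcases eq_or_ne (Real.sin b) 0 with hb0 | hb0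
    · simp [W, hb0]
    · have hqb0 : q.eval (-Real.cos b) = 0 := (mul_eq_zero.1 hqb).resolve_left hb0
      have hd : q.derivative.eval (-Real.cos b) * Real.sin b ≤ 0 := by
        have ht := (hasDerivAt_iff_tendsto_slope_left_right.1 (hasDerivAt_eval_neg_cos q b)).1
        refine le_of_tendsto ht ?_
        filter_upwards [Ioo_mem_nhdsLT hlt] with t ht
        rw [slope_def_field, hqb0]
        exact div_nonpos_of_nonneg_of_nonpos (by linarith [hpos t ht]) (by linarith [ht.2])
      have hsb : 0 ≤ Real.sin b := Real.sin_nonneg_of_nonneg_of_le_pi (ha.trans hlt.le) hb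
      have h2 := hs0 b ⟨hlt, le_rfl⟩
      simp only [W, hqb0]
      have : 0 ≤ √(Real.sin b) * (Real.sin b * (-(q.derivative.eval (-Real.cos b) * Real.sin b))
          * Real.sin (w * (b - a))) := by
        have := neg_nonneg.2 hd
        positivity
      linarith
  linarith

theorem pos_or_neg_of_ne_zero {s : Set ℝ} (hs : IsPreconnected s) {f : ℝ → ℝ}
    (hf : ContinuousOn f s) (h0 : ∀ t ∈ s, f t ≠ 0) :
    (∀ t ∈ s, 0 < f t) ∨ (∀ t ∈ s, f t < 0) := by
  by_contra! h
  obtain ⟨⟨x, hx, hx0⟩, y, hy, hy0⟩ := h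
  obtain ⟨t, ht, ht0⟩ := hs.intermediate_value hx hy hf ⟨hx0, hy0⟩
  exact h0 t ht ht0

theorem exists_legendrePoly_eq_zero {N : ℕ} {a b : ℝ} (ha : 0 < a) (hb : b < Real.pi)
    (hab : ((N : ℝ) + 1 / 2) * (b - a) = Real.pi) :
    ∃ t ∈ Set.Icc a b, (legendrePoly N).eval (-Real.cos t) = 0 := by
  by_contra! h
  rcases pos_or_neg_of_ne_zero isPreconnected_Icc (f := fun t => (legendrePoly N).eval (-Real.cos t))
    (by fun_prop) h with h | h
  · exact not_forall_pos_of_legendre_ode (legendrePoly_ode_s10 N) ha hb hab h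
  · refine not_forall_pos_of_legendre_ode (N := N) (q := -legendrePoly N) (fun x => ?_) ha hb hab
      (fun t ht => ?_)
    · simp only [Polynomial.derivative_neg, Polynomial.eval_neg]
      linear_combination -legendrePoly_ode_s10 N x
    · simpa using h t ht

theorem pi_le_of_derivative_legendrePoly_ne_zero {N : ℕ} {a b : ℝ} (ha : 0 ≤ a) (hlt : a < b)
    (hb : b ≤ Real.pi) (hqa : Real.sin a * (legendrePoly N).derivative.eval (-Real.cos a) = 0)
    (hqb : Real.sin b * (legendrePoly N).derivative.eval (-Real.cos b) = 0)
    (h0 : ∀ t ∈ Set.Ioo a b, (legendrePoly N).derivative.eval (-Real.cos t) ≠ 0) :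
    Real.pi ≤ ((N : ℝ) + 1 / 2) * (b - a) := by
  rcases pos_or_neg_of_ne_zero isPreconnected_Ioo
    (f := fun t => (legendrePoly N).derivative.eval (-Real.cos t)) (by fun_prop) h0 with h | h
  · exact pi_le_of_derivative_legendre_ode (derivative_legendrePoly_ode N) ha hlt hb hqa hqb h
  · refine pi_le_of_derivative_legendre_ode (N := N) (q := -(legendrePoly N).derivative)
      (fun x => ?_) ha hlt hb (by simpa using hqa) (by simpa using hqb) (fun t ht => ?_)
    · simp only [Polynomial.derivative_neg, Polynomial.eval_neg]
      linear_combination -derivative_legendrePoly_ode N x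
    · simpa using h t ht

theorem le_two_pi_of_derivative_legendrePoly_ne_zero {N : ℕ} {a b : ℝ} (ha : 0 ≤ a)
    (hb : b ≤ Real.pi)
    (h0 : ∀ t ∈ Set.Ioo a b, (legendrePoly N).derivative.eval (-Real.cos t) ≠ 0) :
    ((N : ℝ) + 1 / 2) * (b - a) ≤ 2 * Real.pi := by
  by_contra! hab
  set w : ℝ := (N : ℝ) + 1 / 2 with hw
  have hw0 : 0 < w := by positivity
  set l := Real.pi / w with hl
  have hwl : w * l = Real.pi := by rw [hl]; field_simp
  have hl0 : 0 < l := by positivity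
  have hgap : 2 * l < b - a := by
    by_contra! hc
    have := mul_le_mul_of_nonneg_left hc hw0.le
    linarith
  set e := (b - a - 2 * l) / 3 with he
  have he0 : 0 < e := by rw [he]; linarith
  obtain ⟨s, hs, hs0⟩ := exists_legendrePoly_eq_zero (N := N) (a := a + e) (b := a + e + l)
    (by linarith) (by linarith) (by rw [← hwl]; ring)
  obtain ⟨t, ht, ht0⟩ := exists_legendrePoly_eq_zero (N := N) (a := a + 2 * e + l)
    (b := a + 2 * e + 2 * l) (by linarith) (by linarith) (by rw [← hwl]; ring)
  have hst : s < t := by linarith [hs.2, ht.1]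
  obtain ⟨u, hu, hu0⟩ := exists_hasDerivAt_eq_zero hst (by fun_prop)
    (by rw [hs0, ht0]) (fun u _ => hasDerivAt_eval_neg_cos (legendrePoly N) u)
  have hu1 : a < u := by linarith [hs.1, hu.1]
  have hu2 : u < b := by linarith [ht.2, hu.2]
  have hsin := Real.sin_pos_of_pos_of_lt_pi (ha.trans_lt hu1) (hu2.trans_le hb)
  exact h0 u ⟨hu1, hu2⟩ ((mul_eq_zero.1 hu0).resolve_right hsin.ne')

/-- The angular distance of consecutive Legendre-Gauss-Lobatto nodes is comparable to `π / N`. -/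
theorem IsLGLNodes.arccos_gap {N : ℕ} (hN : 1 ≤ N) {ξ : ℕ → ℝ} (hξ : IsLGLNodes N ξ) {k : ℕ}
    (hk : k < N) :
    Real.pi / N / 2 ≤ Real.arccos (-ξ (k + 1)) - Real.arccos (-ξ k) ∧
      Real.arccos (-ξ (k + 1)) - Real.arccos (-ξ k) ≤ 2 * (Real.pi / N) := by
  obtain ⟨hmono, hξ0, hξN, hzero, hall⟩ := hξ
  have hmem : ∀ j ≤ N, -1 ≤ ξ j ∧ ξ j ≤ 1 := fun j hj =>
    ⟨hξ0 ▸ hmono.monotoneOn (Set.mem_Iic.2 (Nat.zero_le N)) (Set.mem_Iic.2 hj) (Nat.zero_le j),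
      hξN ▸ hmono.monotoneOn (Set.mem_Iic.2 hj) (Set.mem_Iic.2 le_rfl) hj⟩
  have hcos : ∀ j ≤ N, Real.cos (Real.arccos (-ξ j)) = -ξ j := fun j hj =>
    Real.cos_arccos (by linarith [(hmem j hj).2]) (by linarith [(hmem j hj).1])
  have hend : ∀ j ≤ N, Real.sin (Real.arccos (-ξ j)) *
      (legendrePoly N).derivative.eval (-Real.cos (Real.arccos (-ξ j))) = 0 := by
    intro j hj
    have h := hzero j hj
    have hsc := Real.sin_sq_add_cos_sq (Real.arccos (-ξ j))
    rw [hcos j hj] at hsc ⊢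
    rw [lglPoly, Polynomial.eval_mul] at h
    simp only [Polynomial.eval_sub, Polynomial.eval_one, Polynomial.eval_pow,
      Polynomial.eval_X] at h
    have : (Real.sin (Real.arccos (-ξ j)) *
      (legendrePoly N).derivative.eval (- -ξ j)) ^ 2 = 0 := by
      rw [neg_neg]
      linear_combination (legendrePoly N).derivative.eval (ξ j) * h +
        (legendrePoly N).derivative.eval (ξ j) ^ 2 * hsc
    exact pow_eq_zero_iff two_ne_zero |>.1 this
  have hlt : ξ k < ξ (k + 1) :=
    hmono (Set.mem_Iic.2 hk.le) (Set.mem_Iic.2 hk) (Nat.lt_succ_self k)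
  set a := Real.arccos (-ξ k) with ha
  set b := Real.arccos (-ξ (k + 1)) with hb
  have hab : a < b := Real.strictAntiOn_arccos
    ⟨by linarith [(hmem _ hk).2], by linarith [(hmem _ hk).1]⟩
    ⟨by linarith [(hmem _ hk.le).2], by linarith [(hmem _ hk.le).1]⟩ (by linarith)
  have ha0 : 0 ≤ a := Real.arccos_nonneg _
  have hbpi : b ≤ Real.pi := Real.arccos_le_pi _
  have hne : ∀ t ∈ Set.Ioo a b, (legendrePoly N).derivative.eval (-Real.cos t) ≠ 0 := by
    intro t ht h0
    obtain ⟨j, hj, hjt⟩ := hall (-Real.cos t) (by simp [lglPoly, h0])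
    have h1 : ξ k < ξ j := by
      have := Real.cos_lt_cos_of_nonneg_of_le_pi ha0 (ht.2.le.trans hbpi) ht.1
      rw [ha, hcos k hk.le] at this
      linarith
    have h2 : ξ j < ξ (k + 1) := by
      have := Real.cos_lt_cos_of_nonneg_of_le_pi (ha0.trans ht.1.le) hbpi ht.2
      rw [hb, hcos _ hk] at this
      linarith
    have h3 := (hmono.lt_iff_lt (Set.mem_Iic.2 hk.le) (Set.mem_Iic.2 hj)).1 h1
    have h4 := (hmono.lt_iff_lt (Set.mem_Iic.2 hj) (Set.mem_Iic.2 hk)).1 h2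
    omega
  have h1 := pi_le_of_derivative_legendrePoly_ne_zero ha0 hab hbpi (hend k hk.le) (hend _ hk) hne
  have h2 := le_two_pi_of_derivative_legendrePoly_ne_zero ha0 hbpi hne
  have hN1 : (1 : ℝ) ≤ N := by exact_mod_cast hN
  have hd : 0 < b - a := sub_pos.2 hab
  constructor
  · rw [div_div, div_le_iff₀ (by positivity)]
    nlinarith
  · rw [← mul_div_assoc, le_div_iff₀ (by positivity)]
    nlinarith

theorem sin_le_pi_mul_sin {x y : ℝ} (hx : 0 ≤ x) (hx' : x ≤ Real.pi) (hy : 0 ≤ y)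
    (hy' : y ≤ Real.pi) (h : x ≤ 2 * y) (h' : Real.pi - x ≤ 2 * (Real.pi - y)) :
    Real.sin x ≤ Real.pi * Real.sin y := by
  have key : ∀ {x y : ℝ}, 0 ≤ x → 0 ≤ y → y ≤ Real.pi / 2 → x ≤ 2 * y →
      Real.sin x ≤ Real.pi * Real.sin y := by
    intro x y hx hy hy2 h
    have h1 := Real.mul_le_sin hy hy2
    have h2 := Real.sin_le hx
    have h3 := mul_le_mul_of_nonneg_left h1 Real.pi_pos.le
    have h4 : Real.pi * (2 / Real.pi * y) = 2 * y := by field_simp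
    linarith
  rcases le_total y (Real.pi / 2) with hy2 | hy2
  · exact key hx hy hy2 h
  · rw [← Real.sin_pi_sub x, ← Real.sin_pi_sub y]
    exact key (by linarith) (by linarith) (by linarith) h'

theorem cos_sub_cos_le_pi_sq_mul {a b c d : ℝ} (ha : 0 ≤ a) (hab : a ≤ b) (hb : b ≤ Real.pi)
    (hc : 0 ≤ c) (hcd : c ≤ d) (hd : d ≤ Real.pi) (h₁ : a ≤ 2 * c) (h₂ : b - a ≤ 2 * (d - c))
    (h₃ : Real.pi - b ≤ 2 * (Real.pi - d)) :
    Real.cos a - Real.cos b ≤ Real.pi ^ 2 * (Real.cos c - Real.cos d) := by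
  have e1 : Real.cos a - Real.cos b = 2 * (Real.sin ((a + b) / 2) * Real.sin ((b - a) / 2)) := by
    rw [Real.cos_sub_cos, ← neg_sub b a, neg_div, Real.sin_neg]
    ring
  have e2 : Real.cos c - Real.cos d = 2 * (Real.sin ((c + d) / 2) * Real.sin ((d - c) / 2)) := by
    rw [Real.cos_sub_cos, ← neg_sub d c, neg_div, Real.sin_neg]
    ring
  have s1 := sin_le_pi_mul_sin (x := (a + b) / 2) (y := (c + d) / 2) (by linarith) (by linarith)
    (by linarith) (by linarith) (by linarith) (by linarith)
  have s2 := sin_le_pi_mul_sin (x := (b - a) / 2) (y := (d - c) / 2) (by linarith) (by linarith)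
    (by linarith) (by linarith) (by linarith) (by linarith)
  have p1 : 0 ≤ Real.sin ((b - a) / 2) :=
    Real.sin_nonneg_of_nonneg_of_le_pi (by linarith) (by linarith)
  have p2 : 0 ≤ Real.sin ((c + d) / 2) :=
    Real.sin_nonneg_of_nonneg_of_le_pi (by linarith) (by linarith)
  have := mul_le_mul s1 s2 p1 (by positivity)
  rw [e1, e2]
  linarith

theorem sub_mem_Icc_of_forall_succ {N : ℕ} {θ : ℕ → ℝ} {l u : ℝ}
    (h : ∀ k < N, l ≤ θ (k + 1) - θ k ∧ θ (k + 1) - θ k ≤ u) {i j : ℕ} (hij : i ≤ j)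
    (hj : j ≤ N) : ((j : ℝ) - i) * l ≤ θ j - θ i ∧ θ j - θ i ≤ ((j : ℝ) - i) * u := by
  induction j, hij using Nat.le_induction with
  | base => simp
  | succ j hij ih =>
    have h1 := ih (by omega)
    have h2 := h j (by omega)
    push_cast
    constructor <;> linarith

/-- Uniform comparability of LGL and CGL intervals: there exist `c₁, c₂ > 0`
such that `c₁·|Λ_k^N| ≤ |Δ_k^N| ≤ c₂·|Λ_k^N|` for every `N ≥ 1` and
`0 ≤ k ≤ N-1`. -/
theorem lgl_cgl_interval_comparability :
    ∃ c₁ c₂ : ℝ, 0 < c₁ ∧ 0 < c₂ ∧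
      ∀ N : ℕ, 1 ≤ N → ∀ ξ : ℕ → ℝ, IsLGLNodes N ξ →
        ∀ k : ℕ, k ≤ N - 1 →
          c₁ * (cgl N (k + 1) - cgl N k) ≤ ξ (k + 1) - ξ k ∧
          ξ (k + 1) - ξ k ≤ c₂ * (cgl N (k + 1) - cgl N k) := by
  refine ⟨(Real.pi ^ 2)⁻¹, Real.pi ^ 2, by positivity, by positivity, ?_⟩
  intro N hN ξ hξ k hk
  have hk : k < N := by omega
  have hgap := fun j (hj : j < N) => hξ.arccos_gap hN hj
  set θ : ℕ → ℝ := fun j => Real.arccos (-ξ j) with hθ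
  have hcos : ∀ j ≤ N, Real.cos (θ j) = -ξ j := by
    obtain ⟨hmono, hξ0, hξN, -, -⟩ := hξ
    intro j hj
    have h1 := hmono.monotoneOn (Set.mem_Iic.2 (Nat.zero_le N)) (Set.mem_Iic.2 hj) (Nat.zero_le j)
    have h2 := hmono.monotoneOn (Set.mem_Iic.2 hj) (Set.mem_Iic.2 le_rfl) hj
    exact Real.cos_arccos (by linarith) (by linarith)
  have hθ0 : θ 0 = 0 := by simp [hθ, hξ.2.1]
  have hθN : θ N = Real.pi := by simp [hθ, hξ.2.2.1]
  have hN0 : (0 : ℝ) < N := by exact_mod_cast hN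
  set h := Real.pi / N with hh
  have hNh : N * h = Real.pi := by rw [hh]; field_simp
  have hh0 : 0 < h := by positivity
  have hkN : (k : ℝ) + 1 ≤ N := by exact_mod_cast hk
  have b1 := sub_mem_Icc_of_forall_succ (θ := θ) hgap (Nat.zero_le k) hk.le
  have b2 := sub_mem_Icc_of_forall_succ (θ := θ) hgap (Nat.succ_le_of_lt hk) le_rfl
  have b3 : h / 2 ≤ θ (k + 1) - θ k ∧ θ (k + 1) - θ k ≤ 2 * h := hgap k hk
  rw [hθ0] at b1
  rw [hθN] at b2
  push_cast at b1 b2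
  have hθk : 0 ≤ θ k := Real.arccos_nonneg _
  have hθk' : θ (k + 1) ≤ Real.pi := Real.arccos_le_pi _
  have hkh : 0 ≤ k * h := by positivity
  have hkh' : (k + 1) * h ≤ Real.pi := by
    rw [← hNh]
    exact mul_le_mul_of_nonneg_right hkN hh0.le
  have e1 : ξ (k + 1) - ξ k = Real.cos (θ k) - Real.cos (θ (k + 1)) := by
    rw [hcos k hk.le, hcos (k + 1) hk]
    ring
  have e2 : cgl N (k + 1) - cgl N k = Real.cos (k * h) - Real.cos ((k + 1) * h) := by
    simp only [cgl, hh]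
    push_cast
    rw [mul_div_assoc, mul_div_assoc]
    ring
  rw [e1, e2]
  constructor
  · rw [inv_mul_le_iff₀ (by positivity)]
    exact cos_sub_cos_le_pi_sq_mul hkh (by linarith) hkh' hθk (by linarith) hθk'
      (by linarith [b1.1]) (by linarith [b3.1]) (by linarith [b2.1])
  · exact cos_sub_cos_le_pi_sq_mul hθk (by linarith) hθk' hkh (by linarith) hkh'
      (by linarith [b1.2]) (by linarith [b3.2]) (by linarith [b2.2])
end
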